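/- The One-Step Graded μ-Calculus is subsumed by MTL: every OSGμC sentence has an MTL sentence satisfied by exactly the same Kripke trees. More precisely, there is a translation t_x from OSGμC fixpoint formulas θ ∈ Θ[Z,O] to MTL formulas such that, for every Kripke tree (T, Lab), every assignment V of the variables in Z ∪ O to subsets of T, and every node w ∈ T, w belongs to the denotation of θ under V if and only if (T, Lab) satisfies t_x(θ) under the first-order valuation mapping x to w and the second-order valuation V. -/

import Mathlib

/-! ## Trees over ℕ* -/

abbrev Node : Type := List ℕ

/-- `T` is a tree with root `r`: `r ∈ T`, every node extends `r`, and `T` is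
prefix-closed above `r`. -/
def IsTreeRooted (T : Set Node) (r : Node) : Prop :=
  r ∈ T ∧ (∀ τ ∈ T, r <+: τ) ∧
    ∀ σ σ' : List ℕ, r ++ σ ∈ T → σ' <+: σ → r ++ σ' ∈ T

/-- `T ⊆ ℕ*` is a tree. -/
def IsTree (T : Set Node) : Prop := ∃ r : Node, IsTreeRooted T r

/-- `τ'` is a child of `τ` in `T`. -/
def childIn (T : Set Node) (τ τ' : Node) : Prop := τ' ∈ T ∧ ∃ n : ℕ, τ' = τ ++ [n]

/-- every node of `T` has a child in `T`. -/
def NonBlocking (T : Set Node) : Prop := ∀ τ ∈ T, ∃ n : ℕ, τ ++ [n] ∈ T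

/-- every node of `T` has finitely many children in `T`. -/
def FinBranching (T : Set Node) : Prop := ∀ τ ∈ T, {τ' : Node | childIn T τ τ'}.Finite

/-- `S` is a subtree of `T`. -/
def IsSubtree (T S : Set Node) : Prop := S ⊆ T ∧ IsTree S

/-- `P` is a path of `T`: a subtree totally ordered by the child relation
(each node has at most one child in `P`). -/
def IsPathOf (T P : Set Node) : Prop :=
  IsSubtree T P ∧ ∀ τ ∈ P, ∀ n m : ℕ, τ ++ [n] ∈ P → τ ++ [m] ∈ P → n = m

/-- `T` is a chain: a tree in which each node has at most one child. -/
def IsChainTree (T : Set Node) : Prop :=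
  IsTree T ∧ ∀ τ ∈ T, ∀ n m : ℕ, τ ++ [n] ∈ T → τ ++ [m] ∈ T → n = m

/-- `T` is dense: it contains a subtree every node of which has a descendant
in the subtree with at least two distinct children in the subtree. -/
def DenseTree (T : Set Node) : Prop :=
  ∃ S : Set Node, IsSubtree T S ∧ ∀ τ ∈ S, ∃ τ' ∈ S, τ <+: τ' ∧
    ∃ n m : ℕ, n ≠ m ∧ τ' ++ [n] ∈ S ∧ τ' ++ [m] ∈ S

/-- A Kripke tree over `AP`: a non-blocking tree together with a labelling. -/
structure KripkeTree (AP : Type) where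
  T : Set Node
  root : Node
  rooted : IsTreeRooted T root
  nonblocking : NonBlocking T
  Lab : Node → Set AP

/-! ## MSOL syntax -/

inductive MSOL (AP : Type) : Type
  | atom : AP → ℕ → MSOL AP          -- P_a(x)
  | le   : ℕ → ℕ → MSOL AP           -- x ≤ y
  | mem  : ℕ → ℕ → MSOL AP           -- x ∈ X
  | not  : MSOL AP → MSOL AP
  | and  : MSOL AP → MSOL AP → MSOL AP
  | exFO : ℕ → MSOL AP → MSOL AP     -- ∃x. φ
  | exSO : ℕ → MSOL AP → MSOL AP     -- ∃X. φ

namespace MSOL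

def freeFO {AP : Type} : MSOL AP → Set ℕ
  | atom _ x => {x}
  | le x y => {x, y}
  | mem x _ => {x}
  | not φ => φ.freeFO
  | and φ ψ => φ.freeFO ∪ ψ.freeFO
  | exFO x φ => φ.freeFO \ {x}
  | exSO _ φ => φ.freeFO

def freeSO {AP : Type} : MSOL AP → Set ℕ
  | atom _ _ => ∅
  | le _ _ => ∅
  | mem _ X => {X}
  | not φ => φ.freeSO
  | and φ ψ => φ.freeSO ∪ ψ.freeSO
  | exFO _ φ => φ.freeSO
  | exSO X φ => φ.freeSO \ {X}

/-- A sentence is a formula with no free variables. -/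
def IsSentence {AP : Type} (φ : MSOL AP) : Prop := φ.freeFO = ∅ ∧ φ.freeSO = ∅

/-- The first-order fragment: no second-order variables. -/
def IsFO {AP : Type} : MSOL AP → Prop
  | atom _ _ => True
  | le _ _ => True
  | mem _ _ => False
  | not φ => φ.IsFO
  | and φ ψ => φ.IsFO ∧ ψ.IsFO
  | exFO _ φ => φ.IsFO
  | exSO _ _ => False

end MSOL

/-! ## MSOL semantics, parametrized by the range of second-order quantifiers -/

/-- A second-order domain: for each tree, the collection of sets that
second-order quantifiers range over. -/
abbrev SODom : Type := Set Node → Set (Set Node)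

def Sat {AP : Type} (D : SODom) (K : KripkeTree AP) :
    (ℕ → Node) → (ℕ → Set Node) → MSOL AP → Prop
  | V1, _,  .atom a x => V1 x ∈ K.T ∧ a ∈ K.Lab (V1 x)
  | V1, _,  .le x y => V1 x ∈ K.T ∧ V1 y ∈ K.T ∧ V1 x <+: V1 y
  | V1, V2, .mem x X => V1 x ∈ V2 X
  | V1, V2, .not φ => ¬ Sat D K V1 V2 φ
  | V1, V2, .and φ ψ => Sat D K V1 V2 φ ∧ Sat D K V1 V2 ψ
  | V1, V2, .exFO x φ => ∃ τ ∈ K.T, Sat D K (Function.update V1 x τ) V2 φ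
  | V1, V2, .exSO X φ => ∃ S ∈ D K.T, Sat D K V1 (Function.update V2 X S) φ

/-- A logic: a syntactic fragment of MSOL together with a second-order domain. -/
structure MLogic (AP : Type) where
  syn : MSOL AP → Prop
  dom : SODom

namespace MLogic

/-- A Kripke tree satisfies a sentence. -/
def KSat {AP : Type} (L : MLogic AP) (K : KripkeTree AP) (φ : MSOL AP) : Prop :=
  ∃ V1 V2, Sat L.dom K V1 V2 φ

/-- `L ≤ L'` over the class `M`. -/
def Leq {AP : Type} (M : Set (KripkeTree AP)) (L L' : MLogic AP) : Prop :=
  ∀ φ : MSOL AP, φ.IsSentence → L.syn φ →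
    ∃ φ' : MSOL AP, φ'.IsSentence ∧ L'.syn φ' ∧
      ∀ K ∈ M, (L.KSat K φ ↔ L'.KSat K φ')

/-- `L < L'` over the class `M`. -/
def Lt {AP : Type} (M : Set (KripkeTree AP)) (L L' : MLogic AP) : Prop :=
  Leq M L L' ∧ ¬ Leq M L' L

/-- `L ≡ L'` over the class `M`. -/
def EquivExp {AP : Type} (M : Set (KripkeTree AP)) (L L' : MLogic AP) : Prop :=
  Leq M L L' ∧ Leq M L' L

/-- `L` and `L'` are expressively incomparable over the class `M`. -/
def Incomp {AP : Type} (M : Set (KripkeTree AP)) (L L' : MLogic AP) : Prop :=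
  ¬ Leq M L L' ∧ ¬ Leq M L' L

end MLogic

/-! ## The concrete logics -/

def MSOdom : SODom := fun T => {S | S ⊆ T}
def MTLdom : SODom := fun T => {S | S ⊆ T ∧ IsTree S}
def MPLdom : SODom := fun T => {S | IsPathOf T S}
def weakDom (D : SODom) : SODom := fun T => {S | S ∈ D T ∧ S.Finite}
def coweakDom (D : SODom) : SODom := fun T => {S | S ∈ D T ∧ S.Infinite}

def MSO (AP : Type) : MLogic AP := ⟨fun _ => True, MSOdom⟩
def MTL (AP : Type) : MLogic AP := ⟨fun _ => True, MTLdom⟩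
def MPL (AP : Type) : MLogic AP := ⟨fun _ => True, MPLdom⟩
def WMSO (AP : Type) : MLogic AP := ⟨fun _ => True, weakDom MSOdom⟩
def WMTL (AP : Type) : MLogic AP := ⟨fun _ => True, weakDom MTLdom⟩
def WMPL (AP : Type) : MLogic AP := ⟨fun _ => True, weakDom MPLdom⟩
def CoWMSO (AP : Type) : MLogic AP := ⟨fun _ => True, coweakDom MSOdom⟩
def CoWMTL (AP : Type) : MLogic AP := ⟨fun _ => True, coweakDom MTLdom⟩
def CoWMPL (AP : Type) : MLogic AP := ⟨fun _ => True, coweakDom MPLdom⟩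
def FOL (AP : Type) : MLogic AP := ⟨MSOL.IsFO, MSOdom⟩

/-! ## Classes of Kripke trees -/

def allKT (AP : Type) : Set (KripkeTree AP) := Set.univ
def finBrKT (AP : Type) : Set (KripkeTree AP) := {K | FinBranching K.T}
/-- Kripke trees whose underlying tree is an infinite chain
(every node has exactly one child). -/
def chainKT (AP : Type) : Set (KripkeTree AP) :=
  {K | ∀ τ ∈ K.T, ∃! τ' : Node, childIn K.T τ τ'}

/-! ## Graded μ-calculus -/

inductive GMC (AP : Type) : Type
  | ff  : GMC AP
  | tt  : GMC AP
  | atom : AP → GMC AP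
  | not : GMC AP → GMC AP
  | and : GMC AP → GMC AP → GMC AP
  | or  : GMC AP → GMC AP → GMC AP
  | var : ℕ → GMC AP
  | dia : ℕ → GMC AP → GMC AP     -- ◇_{≥k} φ
  | box : ℕ → GMC AP → GMC AP     -- □_{<k} φ
  | mu  : ℕ → GMC AP → GMC AP
  | nu  : ℕ → GMC AP → GMC AP

namespace GMC

/-- The set of children of `τ` in `T`. -/
def childrenIn (T : Set Node) (τ : Node) : Set Node := {τ' : Node | childIn T τ τ'}

/-- `S` contains at least `k` elements. -/
def atLeast (k : ℕ) (S : Set Node) : Prop :=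
  ∃ F : Finset Node, F.card = k ∧ ↑F ⊆ S

/-- Denotation of a graded μ-calculus formula in a Kripke tree, under an
assignment of the fixpoint variables to sets of nodes. -/
def denot {AP : Type} (K : KripkeTree AP) : GMC AP → (ℕ → Set Node) → Set Node
  | .ff, _ => ∅
  | .tt, _ => K.T
  | .atom a, _ => {τ ∈ K.T | a ∈ K.Lab τ}
  | .not φ, V => K.T \ denot K φ V
  | .and φ ψ, V => denot K φ V ∩ denot K ψ V
  | .or φ ψ, V => denot K φ V ∪ denot K ψ V
  | .var X, V => V X
  | .dia k φ, V => {τ ∈ K.T | atLeast k (childrenIn K.T τ ∩ denot K φ V)}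
  | .box k φ, V => {τ ∈ K.T | ¬ atLeast k (childrenIn K.T τ \ denot K φ V)}
  | .mu X φ, V => ⋂₀ {W : Set Node | W ⊆ K.T ∧ denot K φ (Function.update V X W) ⊆ W}
  | .nu X φ, V => ⋃₀ {W : Set Node | W ⊆ K.T ∧ W ⊆ denot K φ (Function.update V X W)}

/-- Free fixpoint variables. -/
def free {AP : Type} : GMC AP → Set ℕ
  | .ff => ∅
  | .tt => ∅
  | .atom _ => ∅
  | .not φ => φ.free
  | .and φ ψ => φ.free ∪ ψ.free
  | .or φ ψ => φ.free ∪ ψ.free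
  | .var X => {X}
  | .dia _ φ => φ.free
  | .box _ φ => φ.free
  | .mu X φ => φ.free \ {X}
  | .nu X φ => φ.free \ {X}

/-- Every free occurrence of `X` lies under an even (`b = true`) resp. odd
(`b = false`) number of negations. -/
def polOK {AP : Type} (X : ℕ) : Bool → GMC AP → Prop
  | _, .ff => True
  | _, .tt => True
  | _, .atom _ => True
  | b, .not φ => polOK X (!b) φ
  | b, .and φ ψ => polOK X b φ ∧ polOK X b ψ
  | b, .or φ ψ => polOK X b φ ∧ polOK X b ψ
  | b, .var Y => Y = X → b = true
  | b, .dia _ φ => polOK X b φ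
  | b, .box _ φ => polOK X b φ
  | b, .mu Y φ => Y = X ∨ polOK X b φ
  | b, .nu Y φ => Y = X ∨ polOK X b φ

/-- Every bound variable occurs only positively in the scope of its binder. -/
def boundPos {AP : Type} : GMC AP → Prop
  | .ff => True
  | .tt => True
  | .atom _ => True
  | .not φ => φ.boundPos
  | .and φ ψ => φ.boundPos ∧ ψ.boundPos
  | .or φ ψ => φ.boundPos ∧ ψ.boundPos
  | .var _ => True
  | .dia _ φ => φ.boundPos
  | .box _ φ => φ.boundPos
  | .mu X φ => φ.boundPos ∧ polOK X true φ
  | .nu X φ => φ.boundPos ∧ polOK X true φ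

/-- Every occurrence of every variable (free or bound) is positive. -/
def AllPos {AP : Type} (θ : GMC AP) : Prop :=
  θ.boundPos ∧ ∀ X : ℕ, polOK X true θ

end GMC

mutual
  /-- Base formulas `Φ[Z,O]` of the One-Step Graded μ-Calculus. -/
  inductive IsBase {AP : Type} : Set ℕ → Set ℕ → GMC AP → Prop
    | ff   : ∀ {Z O : Set ℕ}, IsBase Z O .ff
    | tt   : ∀ {Z O : Set ℕ}, IsBase Z O .tt
    | atom : ∀ {Z O : Set ℕ} (a : AP), IsBase Z O (.atom a)
    | not  : ∀ {Z O : Set ℕ} {φ : GMC AP}, IsBase Z O φ → IsBase Z O (.not φ)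
    | and  : ∀ {Z O : Set ℕ} {φ ψ : GMC AP},
        IsBase Z O φ → IsBase Z O ψ → IsBase Z O (.and φ ψ)
    | or   : ∀ {Z O : Set ℕ} {φ ψ : GMC AP},
        IsBase Z O φ → IsBase Z O ψ → IsBase Z O (.or φ ψ)
    | dia  : ∀ {Z O : Set ℕ} {φ : GMC AP} (k : ℕ),
        IsBase O ∅ φ → IsBase Z O (.dia k φ)
    | box  : ∀ {Z O : Set ℕ} {φ : GMC AP} (k : ℕ),
        IsBase O ∅ φ → IsBase Z O (.box k φ)
    | var  : ∀ {Z O : Set ℕ} {X : ℕ}, X ∈ Z → IsBase Z O (.var X)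
    | fix  : ∀ {Z O : Set ℕ} {θ : GMC AP}, IsFix ∅ ∅ θ → IsBase Z O θ
  /-- Fixpoint formulas `Θ[Z,O]` of the One-Step Graded μ-Calculus. -/
  inductive IsFix {AP : Type} : Set ℕ → Set ℕ → GMC AP → Prop
    | mu : ∀ {Z O : Set ℕ} {X : ℕ} {θ : GMC AP},
        IsFix (Z ∪ {X}) (O ∪ {X}) θ → IsFix Z O (.mu X θ)
    | nu : ∀ {Z O : Set ℕ} {X : ℕ} {θ : GMC AP},
        IsFix (Z ∪ {X}) (O ∪ {X}) θ → IsFix Z O (.nu X θ)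
    | base : ∀ {Z O : Set ℕ} {φ : GMC AP}, IsBase Z O φ → IsFix Z O φ
end

/-- A Kripke tree satisfies a μ-calculus sentence iff its root belongs to its
denotation under the empty assignment. -/
def GKSat {AP : Type} (K : KripkeTree AP) (θ : GMC AP) : Prop :=
  K.root ∈ GMC.denot K θ (fun _ => ∅)


namespace OSG

open GMC

/-! ### Basic facts on denotations -/

theorem atLeast_mono {k : ℕ} {S S' : Set Node} (h : S ⊆ S') : atLeast k S → atLeast k S' :=
  fun ⟨F, hc, hF⟩ => ⟨F, hc, hF.trans h⟩

theorem denot_congr {AP : Type} (K : KripkeTree AP) (φ : GMC AP) :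
    ∀ (V V' : ℕ → Set Node), (∀ X ∈ φ.free, V X = V' X) → denot K φ V = denot K φ V' := by
  induction φ with
  | ff => intros; rfl
  | tt => intros; rfl
  | atom a => intros; rfl
  | not φ ih => intro V V' h; simp only [denot]; rw [ih V V' h]
  | and φ ψ ih1 ih2 =>
    intro V V' h; simp only [denot]
    rw [ih1 V V' (fun X hX => h X (Or.inl hX)), ih2 V V' (fun X hX => h X (Or.inr hX))]
  | or φ ψ ih1 ih2 =>
    intro V V' h; simp only [denot]
    rw [ih1 V V' (fun X hX => h X (Or.inl hX)), ih2 V V' (fun X hX => h X (Or.inr hX))]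
  | var X => intro V V' h; exact h X rfl
  | dia k φ ih => intro V V' h; simp only [denot]; rw [ih V V' h]
  | box k φ ih => intro V V' h; simp only [denot]; rw [ih V V' h]
  | mu X φ ih =>
    intro V V' h; simp only [denot]
    have : ∀ W, denot K φ (Function.update V X W) = denot K φ (Function.update V' X W) := by
      intro W
      apply ih
      intro Y hY
      by_cases e : Y = X
      · subst e; simp
      · simp [e, h Y ⟨hY, e⟩]
    simp only [this]
  | nu X φ ih =>
    intro V V' h; simp only [denot]
    have : ∀ W, denot K φ (Function.update V X W) = denot K φ (Function.update V' X W) := by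
      intro W
      apply ih
      intro Y hY
      by_cases e : Y = X
      · subst e; simp
      · simp [e, h Y ⟨hY, e⟩]
    simp only [this]

theorem polOK_of_not_free {AP : Type} (φ : GMC AP) :
    ∀ (X : ℕ) (b : Bool), X ∉ φ.free → polOK X b φ := by
  induction φ with
  | ff => intros; trivial
  | tt => intros; trivial
  | atom a => intros; trivial
  | not φ ih => intro X b h; exact ih X _ h
  | and φ ψ ih1 ih2 =>
    intro X b h
    exact ⟨ih1 X b (fun h' => h (Or.inl h')), ih2 X b (fun h' => h (Or.inr h'))⟩
  | or φ ψ ih1 ih2 =>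
    intro X b h
    exact ⟨ih1 X b (fun h' => h (Or.inl h')), ih2 X b (fun h' => h (Or.inr h'))⟩
  | var Y => intro X b h e; exact absurd e.symm h
  | dia k φ ih => intro X b h; exact ih X b h
  | box k φ ih => intro X b h; exact ih X b h
  | mu Y φ ih =>
    intro X b h
    by_cases e : Y = X
    · exact Or.inl e
    · exact Or.inr (ih X b (fun h' => h ⟨h', fun e' => e e'.symm⟩))
  | nu Y φ ih =>
    intro X b h
    by_cases e : Y = X
    · exact Or.inl e
    · exact Or.inr (ih X b (fun h' => h ⟨h', fun e' => e e'.symm⟩))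

/-- `V ≤ V'` where variables with bad polarity are fixed. -/
def Below {AP : Type} (b : Bool) (φ : GMC AP) (V V' : ℕ → Set Node) : Prop :=
  ∀ X, V X = V' X ∨ (V X ⊆ V' X ∧ polOK X b φ)

theorem Below.update_mu {AP : Type} {b : Bool} {φ ψ : GMC AP} {X : ℕ} {V V' : ℕ → Set Node}
    (hψ : ∀ Y, polOK Y b ψ → X = Y ∨ polOK Y b φ)
    (h : Below b ψ V V') (W : Set Node) :
    Below b φ (Function.update V X W) (Function.update V' X W) := by
  intro Y
  by_cases e : Y = X
  · subst e; simp
  · rcases h Y with h | ⟨h, h'⟩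
    · left; simp [e, h]
    · right
      refine ⟨by simpa [e] using h, ?_⟩
      rcases hψ Y h' with h' | h'
      · exact absurd h'.symm e
      · exact h'

theorem denot_mono_aux {AP : Type} (K : KripkeTree AP) (φ : GMC AP) :
    ∀ (V V' : ℕ → Set Node),
      (Below true φ V V' → denot K φ V ⊆ denot K φ V') ∧
      (Below false φ V V' → denot K φ V' ⊆ denot K φ V) := by
  induction φ with
  | ff => intro V V'; exact ⟨fun _ => subset_rfl, fun _ => subset_rfl⟩
  | tt => intro V V'; exact ⟨fun _ => subset_rfl, fun _ => subset_rfl⟩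
  | atom a => intro V V'; exact ⟨fun _ => subset_rfl, fun _ => subset_rfl⟩
  | not φ ih =>
    intro V V'
    refine ⟨fun h => ?_, fun h => ?_⟩
    · exact Set.diff_subset_diff_right ((ih V V').2 h)
    · exact Set.diff_subset_diff_right ((ih V V').1 h)
  | and φ ψ ih1 ih2 =>
    intro V V'
    refine ⟨fun h => ?_, fun h => ?_⟩
    · exact Set.inter_subset_inter
        ((ih1 V V').1 (fun X => (h X).imp id (fun h => ⟨h.1, h.2.1⟩)))
        ((ih2 V V').1 (fun X => (h X).imp id (fun h => ⟨h.1, h.2.2⟩)))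
    · exact Set.inter_subset_inter
        ((ih1 V V').2 (fun X => (h X).imp id (fun h => ⟨h.1, h.2.1⟩)))
        ((ih2 V V').2 (fun X => (h X).imp id (fun h => ⟨h.1, h.2.2⟩)))
  | or φ ψ ih1 ih2 =>
    intro V V'
    refine ⟨fun h => ?_, fun h => ?_⟩
    · exact Set.union_subset_union
        ((ih1 V V').1 (fun X => (h X).imp id (fun h => ⟨h.1, h.2.1⟩)))
        ((ih2 V V').1 (fun X => (h X).imp id (fun h => ⟨h.1, h.2.2⟩)))
    · exact Set.union_subset_union
        ((ih1 V V').2 (fun X => (h X).imp id (fun h => ⟨h.1, h.2.1⟩)))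
        ((ih2 V V').2 (fun X => (h X).imp id (fun h => ⟨h.1, h.2.2⟩)))
  | var X =>
    intro V V'
    refine ⟨fun h => ?_, fun h => ?_⟩
    · rcases h X with h | h
      · exact h.subset
      · exact h.1
    · rcases h X with h | h
      · exact h.symm.subset
      · exact absurd (h.2 rfl) (by simp)
  | dia k φ ih =>
    intro V V'
    refine ⟨fun h => ?_, fun h => ?_⟩
    · exact fun τ hτ => ⟨hτ.1, atLeast_mono (Set.inter_subset_inter_right _ ((ih V V').1 h)) hτ.2⟩
    · exact fun τ hτ => ⟨hτ.1, atLeast_mono (Set.inter_subset_inter_right _ ((ih V V').2 h)) hτ.2⟩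
  | box k φ ih =>
    intro V V'
    refine ⟨fun h => ?_, fun h => ?_⟩
    · exact fun τ hτ => ⟨hτ.1, fun hh => hτ.2
        (atLeast_mono (Set.diff_subset_diff_right ((ih V V').1 h)) hh)⟩
    · exact fun τ hτ => ⟨hτ.1, fun hh => hτ.2
        (atLeast_mono (Set.diff_subset_diff_right ((ih V V').2 h)) hh)⟩
  | mu X φ ih =>
    intro V V'
    refine ⟨fun h => ?_, fun h => ?_⟩
    · rintro τ hτ W ⟨hW, hW'⟩
      exact hτ W ⟨hW, ((ih _ _).1 (Below.update_mu (fun _ hh => by simpa only [polOK] using hh) h W)).trans hW'⟩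
    · rintro τ hτ W ⟨hW, hW'⟩
      exact hτ W ⟨hW, ((ih _ _).2 (Below.update_mu (fun _ hh => by simpa only [polOK] using hh) h W)).trans hW'⟩
  | nu X φ ih =>
    intro V V'
    refine ⟨fun h => ?_, fun h => ?_⟩
    · rintro τ ⟨W, ⟨hW, hW'⟩, hτ⟩
      exact ⟨W, ⟨hW, hW'.trans ((ih _ _).1 (Below.update_mu (fun _ hh => by simpa only [polOK] using hh) h W))⟩, hτ⟩
    · rintro τ ⟨W, ⟨hW, hW'⟩, hτ⟩
      exact ⟨W, ⟨hW, hW'.trans ((ih _ _).2 (Below.update_mu (fun _ hh => by simpa only [polOK] using hh) h W))⟩, hτ⟩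

theorem denot_mono {AP : Type} (K : KripkeTree AP) {φ : GMC AP} (hφ : φ.AllPos)
    {V V' : ℕ → Set Node} (h : ∀ X, V X ⊆ V' X) : denot K φ V ⊆ denot K φ V' :=
  (denot_mono_aux K φ V V').1 (fun X => Or.inr ⟨h X, hφ.2 X⟩)

theorem upd_sub {T W : Set Node} {V : ℕ → Set Node} (hV : ∀ X, V X ⊆ T) (hW : W ⊆ T) (X : ℕ) :
    ∀ Y, Function.update V X W Y ⊆ T := by
  intro Y
  by_cases e : Y = X
  · subst e; simpa using hW
  · simpa [e] using hV Y

theorem upd_le {W W' : Set Node} (V : ℕ → Set Node) (X : ℕ) (h : W ⊆ W') :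
    ∀ Y, Function.update V X W Y ⊆ Function.update V X W' Y := by
  intro Y
  by_cases e : Y = X
  · subst e; simpa using h
  · simp [e]

theorem denot_sub {AP : Type} (K : KripkeTree AP) (φ : GMC AP) :
    ∀ V : ℕ → Set Node, (∀ X, V X ⊆ K.T) → denot K φ V ⊆ K.T := by
  induction φ with
  | ff => intro V h; exact Set.empty_subset _
  | tt => intro V h; exact subset_rfl
  | atom a => intro V h; exact fun τ h => h.1
  | not φ ih => intro V h; exact Set.diff_subset
  | and φ ψ ih1 ih2 => intro V h; exact Set.inter_subset_left.trans (ih1 V h)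
  | or φ ψ ih1 ih2 => intro V h; exact Set.union_subset (ih1 V h) (ih2 V h)
  | var X => intro V h; exact h X
  | dia k φ ih => intro V h; exact fun τ h => h.1
  | box k φ ih => intro V h; exact fun τ h => h.1
  | mu X φ ih =>
    intro V h τ hτ
    exact hτ K.T ⟨subset_rfl, ih _ (upd_sub h subset_rfl X)⟩
  | nu X φ ih =>
    rintro V h τ ⟨W, ⟨hW, _⟩, hτ⟩
    exact hW hτ

theorem AllPos.mu_body {AP : Type} {X : ℕ} {θ : GMC AP} (h : (GMC.mu X θ).AllPos) :
    θ.AllPos := by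
  refine ⟨h.1.1, fun Y => ?_⟩
  rcases h.2 Y with e | e
  · exact e ▸ h.1.2
  · exact e

theorem AllPos.nu_body {AP : Type} {X : ℕ} {θ : GMC AP} (h : (GMC.nu X θ).AllPos) :
    θ.AllPos := by
  refine ⟨h.1.1, fun Y => ?_⟩
  rcases h.2 Y with e | e
  · exact e ▸ h.1.2
  · exact e

theorem mu_le {AP : Type} (K : KripkeTree AP) {X : ℕ} {θ : GMC AP} {V : ℕ → Set Node}
    {W : Set Node} (hW : W ⊆ K.T) (h : denot K θ (Function.update V X W) ⊆ W) :
    denot K (.mu X θ) V ⊆ W := fun _ hτ => hτ W ⟨hW, h⟩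

theorem le_nu {AP : Type} (K : KripkeTree AP) {X : ℕ} {θ : GMC AP} {V : ℕ → Set Node}
    {W : Set Node} (hW : W ⊆ K.T) (h : W ⊆ denot K θ (Function.update V X W)) :
    W ⊆ denot K (.nu X θ) V := fun _ hτ => ⟨W, ⟨hW, h⟩, hτ⟩

theorem mu_eq {AP : Type} (K : KripkeTree AP) {X : ℕ} {θ : GMC AP} (hθ : θ.AllPos)
    {V : ℕ → Set Node} (hV : ∀ X, V X ⊆ K.T) :
    denot K θ (Function.update V X (denot K (.mu X θ) V)) = denot K (.mu X θ) V := by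
  have h1 : denot K θ (Function.update V X (denot K (.mu X θ) V)) ⊆ denot K (.mu X θ) V := by
    rintro τ hτ W ⟨hW, hW'⟩
    exact hW' (denot_mono K hθ (upd_le V X (mu_le K hW hW')) hτ)
  refine h1.antisymm ?_
  refine mu_le K (denot_sub K _ _ (upd_sub hV (denot_sub K _ _ hV) X)) ?_
  exact denot_mono K hθ (upd_le V X h1)

theorem nu_eq {AP : Type} (K : KripkeTree AP) {X : ℕ} {θ : GMC AP} (hθ : θ.AllPos)
    {V : ℕ → Set Node} (hV : ∀ X, V X ⊆ K.T) :
    denot K θ (Function.update V X (denot K (.nu X θ) V)) = denot K (.nu X θ) V := by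
  have h1 : denot K (.nu X θ) V ⊆ denot K θ (Function.update V X (denot K (.nu X θ) V)) := by
    rintro τ ⟨W, ⟨hW, hW'⟩, hτ⟩
    exact denot_mono K hθ (upd_le V X (le_nu K hW hW')) (hW' hτ)
  refine Set.Subset.antisymm ?_ h1
  refine le_nu K (denot_sub K _ _ (upd_sub hV (denot_sub K _ _ hV) X)) ?_
  exact denot_mono K hθ (upd_le V X h1)

/-! ### Locality -/

theorem free_sub {AP : Type} {Z O : Set ℕ} {θ : GMC AP} (h : IsFix Z O θ) : θ.free ⊆ Z ∪ O := by
  refine IsFix.rec (motive_1 := fun Z O φ _ => φ.free ⊆ Z ∪ O)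
    (motive_2 := fun Z O φ _ => φ.free ⊆ Z ∪ O) ?_ ?_ ?_ ?_ ?_ ?_ ?_ ?_ ?_ ?_ ?_ ?_ ?_ h
  · intro Z O; exact Set.empty_subset _
  · intro Z O; exact Set.empty_subset _
  · intro Z O a; exact Set.empty_subset _
  · intro Z O φ _ ih; exact ih
  · intro Z O φ ψ _ _ ih1 ih2; exact Set.union_subset ih1 ih2
  · intro Z O φ ψ _ _ ih1 ih2; exact Set.union_subset ih1 ih2
  · intro Z O φ k _ ih X hX; exact Or.inr (by simpa using ih hX)
  · intro Z O φ k _ ih X hX; exact Or.inr (by simpa using ih hX)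
  · intro Z O X hX Y hY; left; rw [show Y = X from hY]; exact hX
  · intro Z O θ _ ih X hX; exact absurd (ih hX) (by simp)
  · rintro Z O X θ _ ih Y ⟨hY, hne⟩
    have hne : Y ≠ X := hne
    have := ih hY
    simp only [Set.mem_union, Set.mem_singleton_iff] at this ⊢
    tauto
  · rintro Z O X θ _ ih Y ⟨hY, hne⟩
    have hne : Y ≠ X := hne
    have := ih hY
    simp only [Set.mem_union, Set.mem_singleton_iff] at this ⊢
    tauto
  · intro Z O φ _ ih; exact ih

theorem closed_free {AP : Type} {θ : GMC AP} (h : IsFix ∅ ∅ θ) (X : ℕ) : X ∉ θ.free :=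
  fun hX => absurd (free_sub h hX) (by simp)

theorem locality {AP : Type} (K : KripkeTree AP) {Z O : Set ℕ} {φ : GMC AP} (h : IsBase Z O φ) :
    ∀ (V V' : ℕ → Set Node) (w : Node), (∀ X ∈ Z, (w ∈ V X ↔ w ∈ V' X)) →
      (∀ X ∈ O, ∀ u, childIn K.T w u → (u ∈ V X ↔ u ∈ V' X)) →
      (w ∈ denot K φ V ↔ w ∈ denot K φ V') := by
  refine IsBase.rec (motive_1 := fun Z O φ _ => ∀ (V V' : ℕ → Set Node) (w : Node),
      (∀ X ∈ Z, (w ∈ V X ↔ w ∈ V' X)) →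
      (∀ X ∈ O, ∀ u, childIn K.T w u → (u ∈ V X ↔ u ∈ V' X)) →
      (w ∈ denot K φ V ↔ w ∈ denot K φ V'))
    (motive_2 := fun Z O φ _ => True) ?_ ?_ ?_ ?_ ?_ ?_ ?_ ?_ ?_ ?_ ?_ ?_ ?_ h
  · intros; rfl
  · intros; rfl
  · intros; rfl
  · intro Z O φ _ ih V V' w h1 h2
    exact and_congr Iff.rfl (not_congr (ih V V' w h1 h2))
  · intro Z O φ ψ _ _ ih1 ih2 V V' w h1 h2
    exact and_congr (ih1 V V' w h1 h2) (ih2 V V' w h1 h2)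
  · intro Z O φ ψ _ _ ih1 ih2 V V' w h1 h2
    exact or_congr (ih1 V V' w h1 h2) (ih2 V V' w h1 h2)
  · intro Z O φ k _ ih V V' w h1 h2
    have : childrenIn K.T w ∩ denot K φ V = childrenIn K.T w ∩ denot K φ V' := by
      ext u
      simp only [Set.mem_inter_iff]
      refine and_congr_right fun hu => ih V V' u (fun X hX => h2 X hX u hu) ?_
      intro X hX; exact absurd hX (by simp)
    simp only [denot, Set.mem_setOf_eq, this]
  · intro Z O φ k _ ih V V' w h1 h2
    have : childrenIn K.T w \ denot K φ V = childrenIn K.T w \ denot K φ V' := by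
      ext u
      simp only [Set.mem_diff]
      refine and_congr_right fun hu => not_congr (ih V V' u (fun X hX => h2 X hX u hu) ?_)
      intro X hX; exact absurd hX (by simp)
    simp only [denot, Set.mem_setOf_eq, this]
  · intro Z O X hX V V' w h1 h2; exact h1 X hX
  · intro Z O θ hθ _ V V' w h1 h2
    rw [denot_congr K θ V V' (fun X hX => absurd hX (closed_free hθ X))]
  · intros; trivial
  · intros; trivial
  · intros; trivial

/-! ### Shrinking fixpoints to connected components -/

/-- `C` together with its children. -/
def hull (T C : Set Node) : Set Node := {v | v ∈ C ∨ ∃ u ∈ C, childIn T u v}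

theorem base_shrink {AP : Type} (K : KripkeTree AP) {Z O : Set ℕ} {φ : GMC AP}
    (h : IsBase Z O φ) (hp : φ.AllPos) (C : Set Node) (V V' : ℕ → Set Node)
    (hV : ∀ X, V X ∩ hull K.T C ⊆ V' X) : denot K φ V ∩ C ⊆ denot K φ V' := by
  rintro w ⟨hw, hC⟩
  apply denot_mono K hp hV
  refine (locality K h V _ w (fun X _ => ?_) (fun X _ u hu => ?_)).1 hw
  · exact ⟨fun h => ⟨h, Or.inl hC⟩, fun h => h.1⟩
  · exact ⟨fun h => ⟨h, Or.inr ⟨w, hC, hu⟩⟩, fun h => h.1⟩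

theorem upd_hull {V V' : ℕ → Set Node} {D W W' : Set Node} (hV : ∀ X, V X ∩ D ⊆ V' X)
    (h : W ∩ D ⊆ W') (X : ℕ) :
    ∀ Y, Function.update V X W Y ∩ D ⊆ Function.update V' X W' Y := by
  intro Y
  by_cases e : Y = X
  · subst e; simpa using h
  · simpa [e] using hV Y

theorem shrink {AP : Type} (K : KripkeTree AP) (A C : Set Node)
    (hD : hull K.T C ∩ A ⊆ C) (hCT : C ⊆ K.T)
    {Z O : Set ℕ} {θ : GMC AP} (h : IsFix Z O θ) : θ.AllPos →
    ∀ V V' : ℕ → Set Node, (∀ X, V X ⊆ K.T) → (∀ X, V' X ⊆ K.T) →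
      (∀ X, V X ∩ hull K.T C ⊆ V' X) → denot K θ V ⊆ A →
      denot K θ V ∩ C ⊆ denot K θ V' := by
  refine IsFix.rec (motive_1 := fun Z O φ _ => True)
    (motive_2 := fun Z O θ _ => θ.AllPos →
      ∀ V V' : ℕ → Set Node, (∀ X, V X ⊆ K.T) → (∀ X, V' X ⊆ K.T) →
      (∀ X, V X ∩ hull K.T C ⊆ V' X) → denot K θ V ⊆ A →
      denot K θ V ∩ C ⊆ denot K θ V') ?_ ?_ ?_ ?_ ?_ ?_ ?_ ?_ ?_ ?_ ?_ ?_ ?_ h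
  all_goals try (intros; trivial)
  · intro Z O X θ _ ih hp V V' hV hV' hVV hA
    have hp' := AllPos.mu_body hp
    set M := denot K (.mu X θ) V with hM
    set M' := denot K (.mu X θ) V' with hM'
    have hMT : M ⊆ K.T := denot_sub K _ _ hV
    have hMT' : M' ⊆ K.T := denot_sub K _ _ hV'
    have e1 : denot K θ (Function.update V X M) = M := mu_eq K hp' hV
    have e2 : denot K θ (Function.update V' X M') = M' := mu_eq K hp' hV'
    let W : Set Node := {v | v ∈ M ∧ (v ∈ C → v ∈ M')}
    have hWM : W ⊆ M := fun v hv => hv.1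
    have hle : denot K θ (Function.update V X W) ⊆ M := by
      rw [← e1]; exact denot_mono K hp' (upd_le V X hWM)
    have key := ih hp' (Function.update V X W) (Function.update V' X M')
      (upd_sub hV (hWM.trans hMT) X) (upd_sub hV' hMT' X)
      (upd_hull hVV (fun v hv => hv.1.2 (hD ⟨hv.2, hA hv.1.1⟩)) X) (hle.trans hA)
    rw [e2] at key
    have hMW : M ⊆ W := mu_le K (hWM.trans hMT) (fun v hv => ⟨hle hv, fun hC => key ⟨hv, hC⟩⟩)
    exact fun v hv => (hMW hv.1).2 hv.2
  · intro Z O X θ _ ih hp V V' hV hV' hVV hA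
    have hp' := AllPos.nu_body hp
    set N := denot K (.nu X θ) V with hN
    have hNT : N ⊆ K.T := denot_sub K _ _ hV
    have e1 : denot K θ (Function.update V X N) = N := nu_eq K hp' hV
    have hNC : N ∩ C ⊆ K.T := Set.inter_subset_left.trans hNT
    have key := ih hp' (Function.update V X N) (Function.update V' X (N ∩ C))
      (upd_sub hV hNT X) (upd_sub hV' hNC X)
      (upd_hull hVV (W := N) (W' := N ∩ C) (fun v hv => ⟨hv.1, hD ⟨hv.2, hA hv.1⟩⟩) X)
      (e1.subset.trans hA)
    rw [e1] at key
    exact le_nu K hNC key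
  · intro Z O φ hφ _ hp V V' hV hV' hVV hA
    exact base_shrink K hφ hp C V V' hVV

theorem coshrink {AP : Type} (K : KripkeTree AP) (A C : Set Node)
    (hD : hull K.T C ∩ A ⊆ C) (hCT : C ⊆ K.T)
    {Z O : Set ℕ} {θ : GMC AP} (h : IsFix Z O θ) : θ.AllPos →
    ∀ V V' : ℕ → Set Node, (∀ X, V X ⊆ K.T) → (∀ X, V' X ⊆ K.T) →
      (∀ X, V' X ∩ hull K.T C ⊆ V X) → K.T \ A ⊆ denot K θ V →
      denot K θ V' ∩ C ⊆ denot K θ V := by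
  refine IsFix.rec (motive_1 := fun Z O φ _ => True)
    (motive_2 := fun Z O θ _ => θ.AllPos →
      ∀ V V' : ℕ → Set Node, (∀ X, V X ⊆ K.T) → (∀ X, V' X ⊆ K.T) →
      (∀ X, V' X ∩ hull K.T C ⊆ V X) → K.T \ A ⊆ denot K θ V →
      denot K θ V' ∩ C ⊆ denot K θ V) ?_ ?_ ?_ ?_ ?_ ?_ ?_ ?_ ?_ ?_ ?_ ?_ ?_ h
  all_goals try (intros; trivial)
  · intro Z O X θ _ ih hp V V' hV hV' hVV hA
    have hp' := AllPos.mu_body hp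
    set M := denot K (.mu X θ) V with hM
    have hMT : M ⊆ K.T := denot_sub K _ _ hV
    have e1 : denot K θ (Function.update V X M) = M := mu_eq K hp' hV
    let W : Set Node := {v | v ∈ K.T ∧ (v ∈ C → v ∈ M)}
    have hWT : W ⊆ K.T := fun v hv => hv.1
    have key := ih hp' (Function.update V X M) (Function.update V' X W)
      (upd_sub hV hMT X) (upd_sub hV' hWT X)
      (upd_hull hVV (fun v hv => by
        by_cases hc : v ∈ C
        · exact hv.1.2 hc
        · exact hA ⟨hv.1.1, fun ha => hc (hD ⟨hv.2, ha⟩)⟩) X) (e1.symm ▸ hA)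
    rw [e1] at key
    have hMW := mu_le K hWT (V := V') (X := X) (θ := θ)
      (fun v hv => ⟨denot_sub K _ _ (upd_sub hV' hWT X) hv, fun hC => key ⟨hv, hC⟩⟩)
    exact fun v hv => (hMW hv.1).2 hv.2
  · intro Z O X θ _ ih hp V V' hV hV' hVV hA
    have hp' := AllPos.nu_body hp
    set N := denot K (.nu X θ) V with hN
    set N' := denot K (.nu X θ) V' with hN'
    have hNT : N ⊆ K.T := denot_sub K _ _ hV
    have hNT' : N' ⊆ K.T := denot_sub K _ _ hV'
    have e1 : denot K θ (Function.update V X N) = N := nu_eq K hp' hV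
    have e2 : denot K θ (Function.update V' X N') = N' := nu_eq K hp' hV'
    let W : Set Node := N ∪ (N' ∩ C)
    have hWT : W ⊆ K.T := Set.union_subset hNT (Set.inter_subset_left.trans hNT')
    have hle : N ⊆ denot K θ (Function.update V X W) := by
      conv_lhs => rw [← e1]
      exact denot_mono K hp' (upd_le V X Set.subset_union_left)
    have key := ih hp' (Function.update V X W) (Function.update V' X N')
      (upd_sub hV hWT X) (upd_sub hV' hNT' X)
      (upd_hull hVV (fun v hv => by
        by_cases hc : v ∈ C
        · exact Or.inr ⟨hv.1, hc⟩
        · exact Or.inl (hA ⟨hNT' hv.1, fun ha => hc (hD ⟨hv.2, ha⟩)⟩)) X) (hA.trans hle)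
    rw [e2] at key
    have := le_nu K hWT (Set.union_subset hle key)
    exact fun v hv => this (Or.inr hv)
  · intro Z O φ hφ _ hp V V' hV hV' hVV hA
    exact base_shrink K hφ hp C V' V hVV

/-- connected component of `w` in `A`, below `w`. -/
def comp (A : Set Node) (w : Node) : Set Node :=
  {v | w <+: v ∧ ∀ u, w <+: u → u <+: v → u ∈ A}

theorem comp_sub (A : Set Node) (w : Node) : comp A w ⊆ A :=
  fun v hv => hv.2 v hv.1 List.prefix_rfl

theorem pre_antisymm {u v : Node} (h : u <+: v) (h' : v <+: u) : u = v :=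
  h.eq_of_length (le_antisymm h.length_le h'.length_le)

theorem mem_comp {A : Set Node} {w : Node} (h : w ∈ A) : w ∈ comp A w :=
  ⟨List.prefix_rfl, fun u h1 h2 => pre_antisymm h1 h2 ▸ h⟩

theorem comp_tree {A : Set Node} {w : Node} (h : w ∈ A) : IsTree (comp A w) := by
  refine ⟨w, mem_comp h, fun τ hτ => hτ.1, ?_⟩
  intro σ σ' hσ hp
  refine ⟨List.prefix_append _ _, fun u h1 h2 => hσ.2 u h1 (h2.trans ?_)⟩
  exact (List.prefix_append_right_inj w).2 hp

theorem comp_hull (T A : Set Node) (w : Node) : hull T (comp A w) ∩ A ⊆ comp A w := by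
  rintro v ⟨hv | ⟨u, hu, _, n, rfl⟩, hA⟩
  · exact hv
  · refine ⟨hu.1.trans (List.prefix_append _ _), fun z h1 h2 => ?_⟩
    rcases List.prefix_concat_iff.1 h2 with h2 | h2
    · exact h2 ▸ hA
    · exact hu.2 z h1 h2

theorem nu_iff {AP : Type} (K : KripkeTree AP) {Z O : Set ℕ} {θ : GMC AP} {X : ℕ}
    (h : IsFix Z O θ) (hp : θ.AllPos) {V : ℕ → Set Node} (hV : ∀ X, V X ⊆ K.T) (w : Node) :
    w ∈ denot K (.nu X θ) V ↔
      ∃ S ∈ MTLdom K.T, w ∈ S ∧ S ⊆ denot K θ (Function.update V X S) := by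
  constructor
  · intro hw
    set A := denot K (.nu X θ) V with hA
    have hAT : A ⊆ K.T := denot_sub K _ _ hV
    have e1 : denot K θ (Function.update V X A) = A := nu_eq K hp hV
    have hCT := (comp_sub A w).trans hAT
    have key := shrink K A (comp A w) (comp_hull _ A w) hCT h hp
      (Function.update V X A) (Function.update V X (comp A w)) (upd_sub hV hAT X)
      (upd_sub hV hCT X)
      (upd_hull (fun _ => Set.inter_subset_left)
        (fun v hv => comp_hull _ A w ⟨hv.2, hv.1⟩) X) e1.subset
    rw [e1] at key
    exact ⟨comp A w, ⟨hCT, comp_tree hw⟩, mem_comp hw,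
      fun v hv => key ⟨comp_sub A w hv, hv⟩⟩
  · rintro ⟨S, hS, hw, hle⟩
    exact le_nu K hS.1 hle hw

theorem mu_iff {AP : Type} (K : KripkeTree AP) {Z O : Set ℕ} {θ : GMC AP} {X : ℕ}
    (h : IsFix Z O θ) (hp : θ.AllPos) {V : ℕ → Set Node} (hV : ∀ X, V X ⊆ K.T) (w : Node)
    (hwT : w ∈ K.T) :
    w ∈ denot K (.mu X θ) V ↔
      ¬ ∃ S ∈ MTLdom K.T, w ∈ S ∧ ∀ v ∈ S, v ∉ denot K θ (Function.update V X (K.T \ S)) := by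
  rw [← not_iff_not, not_not]
  constructor
  · intro hw
    set M := denot K (.mu X θ) V with hM
    have hMT : M ⊆ K.T := denot_sub K _ _ hV
    have e1 : denot K θ (Function.update V X M) = M := mu_eq K hp hV
    have hwA : w ∈ K.T \ M := ⟨hwT, hw⟩
    have hCT := (comp_sub (K.T \ M) w).trans Set.diff_subset
    have hsub : K.T \ (K.T \ M) ⊆ M := by
      intro v hv
      by_contra hc
      exact hv.2 ⟨hv.1, hc⟩
    have key := coshrink K (K.T \ M) (comp (K.T \ M) w) (comp_hull _ _ w) hCT h hp
      (Function.update V X M) (Function.update V X (K.T \ comp (K.T \ M) w)) (upd_sub hV hMT X)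
      (upd_sub hV Set.diff_subset X)
      (upd_hull (fun _ => Set.inter_subset_left)
        (fun v hv => by
          by_contra hc
          exact hv.1.2 (comp_hull K.T (K.T \ M) w ⟨hv.2, hv.1.1, hc⟩)) X) (e1.symm ▸ hsub)
    rw [e1] at key
    exact ⟨comp (K.T \ M) w, ⟨hCT, comp_tree hwA⟩, mem_comp hwA,
      fun v hv hd => (comp_sub _ w hv).2 (key ⟨hd, hv⟩)⟩
  · rintro ⟨S, hS, hw, hle⟩ hm
    have := mu_le K (W := K.T \ S) Set.diff_subset (V := V) (X := X) (θ := θ)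
      (fun v hv => ⟨denot_sub K _ _ (upd_sub hV Set.diff_subset X) hv, fun hs => hle v hs hv⟩) hm
    exact this.2 hw

/-! ### The translation -/

/-- `y` is a child of `x`. -/
def fChild {AP : Type} (x y : ℕ) : MSOL AP :=
  .and (.and (.le x y) (.not (.le y x)))
    (.not (.exFO (x + y + 1)
      (.and (.and (.le x (x + y + 1)) (.not (.le (x + y + 1) x)))
        (.and (.le (x + y + 1) y) (.not (.le y (x + y + 1)))))))

/-- `y` differs from `x+1, …, x+j`. -/
def fDiff {AP : Type} (x y : ℕ) : ℕ → MSOL AP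
  | 0 => .le x x
  | j + 1 => .and (fDiff x y j) (.not (.and (.le (x + j + 1) y) (.le y (x + j + 1))))

/-- there are `k` further distinct children of `x` satisfying `ψ`. -/
def fDia {AP : Type} (x : ℕ) (ψ : ℕ → MSOL AP) : ℕ → ℕ → MSOL AP
  | _, 0 => .le x x
  | j, k + 1 => .exFO (x + j + 1)
      (.and (.and (fChild x (x + j + 1)) (ψ (x + j + 1)))
        (.and (fDiff x (x + j + 1) j) (fDia x ψ (j + 1) k)))

def tr {AP : Type} : GMC AP → (ℕ → Bool) → ℕ → MSOL AP
  | .ff, _, x => .not (.le x x)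
  | .tt, _, x => .le x x
  | .atom a, _, x => .atom a x
  | .not φ, σ, x => .not (tr φ σ x)
  | .and φ ψ, σ, x => .and (tr φ σ x) (tr ψ σ x)
  | .or φ ψ, σ, x => .not (.and (.not (tr φ σ x)) (.not (tr ψ σ x)))
  | .var X, σ, x => if σ X = true then .mem x X else .not (.mem x X)
  | .dia k φ, σ, x => fDia x (fun y => tr φ σ y) 0 k
  | .box k φ, σ, x => .not (fDia x (fun y => .not (tr φ σ y)) 0 k)
  | .mu X φ, σ, x => .not (.exSO X (.and (.mem x X)
      (.not (.exFO x (.and (.mem x X) (tr φ (Function.update σ X false) x))))))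
  | .nu X φ, σ, x => .exSO X (.and (.mem x X)
      (.not (.exFO x (.and (.mem x X) (.not (tr φ (Function.update σ X true) x))))))

/-- The assignment represented by a second-order valuation and a sign function. -/
def env {AP : Type} (K : KripkeTree AP) (σ : ℕ → Bool) (V : ℕ → Set Node) : ℕ → Set Node :=
  fun X => if σ X = true then V X ∩ K.T else K.T \ V X

theorem env_sub {AP : Type} (K : KripkeTree AP) (σ : ℕ → Bool) (V : ℕ → Set Node) (X : ℕ) :
    env K σ V X ⊆ K.T := by
  unfold env
  split_ifs
  · exact Set.inter_subset_right
  · exact Set.diff_subset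

theorem env_upd_true {AP : Type} (K : KripkeTree AP) (σ : ℕ → Bool) (V : ℕ → Set Node) (X : ℕ)
    {S : Set Node} (hS : S ⊆ K.T) :
    env K (Function.update σ X true) (Function.update V X S)
      = Function.update (env K σ V) X S := by
  funext Y
  by_cases e : Y = X
  · subst e; simpa [env] using hS
  · simp [env, e]

theorem env_upd_false {AP : Type} (K : KripkeTree AP) (σ : ℕ → Bool) (V : ℕ → Set Node) (X : ℕ)
    (S : Set Node) :
    env K (Function.update σ X false) (Function.update V X S)
      = Function.update (env K σ V) X (K.T \ S) := by
  funext Y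
  by_cases e : Y = X
  · subst e; simp [env]
  · simp [env, e]

theorem between {AP : Type} (K : KripkeTree AP) {u z v : Node} (hu : u ∈ K.T) (hv : v ∈ K.T)
    (h1 : u <+: z) (h2 : z <+: v) : z ∈ K.T := by
  obtain ⟨s, rfl⟩ := (K.rooted.2.1 u hu).trans h1
  obtain ⟨s', rfl⟩ := K.rooted.2.1 v hv
  exact K.rooted.2.2 s' s hv ((List.prefix_append_right_inj _).1 h2)

theorem sat_child {AP : Type} (D : SODom) (K : KripkeTree AP) (x y : ℕ) (V1 : ℕ → Node)
    (V2 : ℕ → Set Node) (hx : V1 x ∈ K.T) :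
    Sat D K V1 V2 (fChild x y) ↔ childIn K.T (V1 x) (V1 y) := by
  have n1 : x ≠ x + y + 1 := by omega
  have n2 : y ≠ x + y + 1 := by omega
  simp only [fChild, Sat, Function.update_self, Function.update_of_ne n1, Function.update_of_ne n2]
  constructor
  · rintro ⟨⟨⟨_, hy, hxy⟩, hn⟩, hb⟩
    refine ⟨hy, ?_⟩
    obtain ⟨s, hs⟩ := hxy
    cases s with
    | nil => 
      exfalso; apply hn
      rw [← hs]; simp [hx]
    | cons n l =>
      refine ⟨n, ?_⟩
      by_contra hne
      have p1 : V1 x <+: V1 x ++ [n] := List.prefix_append _ _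
      have p2 : V1 x ++ [n] <+: V1 y := ⟨l, by rw [← hs]; simp⟩
      have hz := between K hx hy p1 p2
      refine hb ⟨V1 x ++ [n], hz, ⟨⟨hx, hz, p1⟩, fun h => ?_⟩, ⟨hz, hy, p2⟩, fun h => ?_⟩
      · have := h.2.2.length_le
        simp at this
      · exact hne (pre_antisymm h.2.2 p2)
  · rintro ⟨hy, n, hn⟩
    refine ⟨⟨⟨hx, hy, hn ▸ List.prefix_append _ _⟩, fun h => ?_⟩, ?_⟩
    · have := h.2.2.length_le
      rw [hn] at this
      simp at this
    · rintro ⟨z, hz, ⟨⟨_, _, h1⟩, h2⟩, ⟨_, _, h3⟩, h4⟩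
      rw [hn] at h3
      rcases List.prefix_concat_iff.1 h3 with h | h
      · exact h4 ⟨hy, hz, by rw [hn, h]⟩
      · exact h2 ⟨hz, hx, h⟩

theorem sat_diff {AP : Type} (D : SODom) (K : KripkeTree AP) (x y : ℕ) (V1 : ℕ → Node)
    (V2 : ℕ → Set Node) (hx : V1 x ∈ K.T) (hy : V1 y ∈ K.T) (j : ℕ)  :
    Sat D K V1 V2 (fDiff x y j) ↔ ∀ i < j, V1 (x + i + 1) ≠ V1 y := by
  induction j with
  | zero => simp [fDiff, Sat, hx]
  | succ j ih =>
    simp only [fDiff, Sat, ih]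
    constructor
    · rintro ⟨h1, h2⟩ i hi e
      rcases Nat.lt_succ_iff_lt_or_eq.1 hi with h | h
      · exact h1 i h e
      · subst h
        rw [e] at h2
        exact h2 ⟨⟨hy, hy, List.prefix_rfl⟩, ⟨hy, hy, List.prefix_rfl⟩⟩
    · intro h
      refine ⟨fun i hi => h i (by omega), fun hh => h j (by omega) ?_⟩
      exact pre_antisymm hh.1.2.2 hh.2.2.2

theorem sat_dia {AP : Type} (D : SODom) (K : KripkeTree AP) (x : ℕ) (ψ : ℕ → MSOL AP)
    (V2 : ℕ → Set Node) (P : Set Node)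
    (hψ : ∀ (V1 : ℕ → Node) (y : ℕ), V1 y ∈ K.T → (Sat D K V1 V2 (ψ y) ↔ V1 y ∈ P)) (k : ℕ) :
    ∀ (j : ℕ) (V1 : ℕ → Node), V1 x ∈ K.T → (Sat D K V1 V2 (fDia x ψ j k) ↔
      ∃ F : Finset Node, F.card = k ∧ ↑F ⊆ childrenIn K.T (V1 x) ∩ P ∧
        ∀ i < j, V1 (x + i + 1) ∉ F) := by
  induction k with
  | zero =>
    intro j V1 hx
    simp only [fDia, Sat]
    exact ⟨fun _ => ⟨∅, by simp, by simp, by simp⟩, fun _ => ⟨hx, hx, List.prefix_rfl⟩⟩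
  | succ k ih =>
    intro j V1 hx
    have n1 : x ≠ x + j + 1 := by omega
    have n2 : ∀ i < j, x + i + 1 ≠ x + j + 1 := by intro i hi; omega
    have main : ∀ τ ∈ K.T, (Sat D K (Function.update V1 (x + j + 1) τ) V2
        (.and (.and (fChild x (x + j + 1)) (ψ (x + j + 1)))
          (.and (fDiff x (x + j + 1) j) (fDia x ψ (j + 1) k))) ↔
        (childIn K.T (V1 x) τ ∧ τ ∈ P) ∧ (∀ i < j, V1 (x + i + 1) ≠ τ) ∧
        ∃ F : Finset Node, F.card = k ∧ ↑F ⊆ childrenIn K.T (V1 x) ∩ P ∧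
        (∀ i < j, V1 (x + i + 1) ∉ F) ∧ τ ∉ F) := by
      intro τ hτ
      have hx' : Function.update V1 (x + j + 1) τ x = V1 x := Function.update_of_ne n1 _ _
      have hy' : Function.update V1 (x + j + 1) τ (x + j + 1) = τ := Function.update_self _ _ _
      have hi' : ∀ i < j, Function.update V1 (x + j + 1) τ (x + i + 1) = V1 (x + i + 1) :=
        fun i hi => Function.update_of_ne (n2 i hi) _ _
      have e1 := sat_child D K x (x + j + 1) (Function.update V1 (x + j + 1) τ) V2 (by rwa [hx'])
      have e2 := hψ (Function.update V1 (x + j + 1) τ) (x + j + 1) (by rwa [hy'])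
      have e3 := sat_diff D K x (x + j + 1) (Function.update V1 (x + j + 1) τ) V2 (by rwa [hx'])
        (by rwa [hy']) j
      have e4 := ih (j + 1) (Function.update V1 (x + j + 1) τ) (by rwa [hx'])
      simp only [Sat, e1, e2, e3, e4, hx', hy']
      refine and_congr Iff.rfl (and_congr ?_ ?_)
      · exact forall₂_congr fun i hi => by rw [hi' i hi]
      · refine exists_congr fun F => and_congr Iff.rfl (and_congr Iff.rfl ?_)
        constructor
        · intro h
          refine ⟨fun i hi => ?_, ?_⟩
          · have := h i (by omega)
            rwa [hi' i hi] at this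
          · have := h j (by omega)
            rwa [hy'] at this
        · rintro ⟨h1, h2⟩ i hi
          rcases Nat.lt_succ_iff_lt_or_eq.1 hi with h | h
          · rw [hi' i h]; exact h1 i h
          · subst h; rwa [hy']
    show (∃ τ ∈ K.T, Sat D K (Function.update V1 (x + j + 1) τ) V2 _) ↔ _
    constructor
    · rintro ⟨τ, hτ, hs⟩
      obtain ⟨⟨hc, hP⟩, hd, F, hF, hsub, hi, hn⟩ := (main τ hτ).1 hs
      refine ⟨insert τ F, by rw [Finset.card_insert_of_notMem hn, hF], ?_, ?_⟩
      · rw [Finset.coe_insert]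
        exact Set.insert_subset ⟨hc, hP⟩ hsub
      · intro i hij hm
        rcases Finset.mem_insert.1 hm with h | h
        · exact hd i hij h
        · exact hi i hij h
    · rintro ⟨F, hF, hsub, hi⟩
      obtain ⟨τ, hτ⟩ : F.Nonempty := by
        rw [← Finset.card_pos]; omega
      have h := hsub hτ
      refine ⟨τ, h.1.1, (main τ h.1.1).2 ⟨h, fun i hij e => hi i hij (e ▸ hτ), F.erase τ, ?_, ?_,
        ?_, ?_⟩⟩
      · rw [Finset.card_erase_of_mem hτ, hF]; rfl
      · exact fun v hv => hsub (Finset.mem_of_mem_erase hv)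
      · exact fun i hij hm => hi i hij (Finset.mem_of_mem_erase hm)
      · exact Finset.notMem_erase _ _

/-- correctness of the translation for a formula. -/
def Good {AP : Type} (K : KripkeTree AP) (φ : GMC AP) : Prop :=
  ∀ (σ : ℕ → Bool) (x : ℕ) (V1 : ℕ → Node) (V2 : ℕ → Set Node), V1 x ∈ K.T →
    (Sat MTLdom K V1 V2 (tr φ σ x) ↔ V1 x ∈ denot K φ (env K σ V2))

theorem good {AP : Type} (K : KripkeTree AP) {Z O : Set ℕ} {θ : GMC AP} (h : IsFix Z O θ) :
    θ.AllPos → Good K θ := by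
  refine IsFix.rec (motive_1 := fun Z O φ _ => φ.boundPos → Good K φ)
    (motive_2 := fun Z O θ _ => θ.AllPos → Good K θ) ?_ ?_ ?_ ?_ ?_ ?_ ?_ ?_ ?_ ?_ ?_ ?_ ?_ h
  · intro Z O _ σ x V1 V2 hx
    simp [tr, Sat, denot, hx]
  · intro Z O _ σ x V1 V2 hx
    simp [tr, Sat, denot, hx]
  · intro Z O a _ σ x V1 V2 hx
    simp [tr, Sat, denot]
  · intro Z O φ _ ih hb σ x V1 V2 hx
    simp [tr, Sat, denot, hx, ih hb σ x V1 V2 hx]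
  · intro Z O φ ψ _ _ ih1 ih2 hb σ x V1 V2 hx
    simp [tr, Sat, denot, ih1 hb.1 σ x V1 V2 hx, ih2 hb.2 σ x V1 V2 hx]
  · intro Z O φ ψ _ _ ih1 ih2 hb σ x V1 V2 hx
    simp only [tr, Sat, denot, ih1 hb.1 σ x V1 V2 hx, ih2 hb.2 σ x V1 V2 hx, Set.mem_union]
    tauto
  · intro Z O φ k _ ih hb σ x V1 V2 hx
    have := sat_dia MTLdom K x (fun y => tr φ σ y) V2 (denot K φ (env K σ V2))
      (fun V1 y hy => ih hb σ y V1 V2 hy) k 0 V1 hx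
    simp only [tr, this]
    simp [denot, atLeast, hx]
  · intro Z O φ k _ ih hb σ x V1 V2 hx
    have := sat_dia MTLdom K x (fun y => .not (tr φ σ y)) V2 (denot K φ (env K σ V2))ᶜ
      (fun V1 y hy => not_congr (ih hb σ y V1 V2 hy)) k 0 V1 hx
    simp only [tr, Sat, this]
    simp [denot, atLeast, hx, Set.diff_eq]
  · intro Z O X _ _ σ x V1 V2 hx
    by_cases hs : σ X = true
    · simp [tr, Sat, denot, env, hs, hx]
    · simp [tr, Sat, denot, env, hs, hx]
  · intro Z O θ hθ ih hb
    exact ih ⟨hb, fun X => polOK_of_not_free θ X true (closed_free hθ X)⟩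
  · intro Z O X θ hθ ih hp σ x V1 V2 hx
    have hp' := AllPos.mu_body hp
    rw [mu_iff K hθ hp' (env_sub K σ V2) _ hx]
    simp only [tr, Sat]
    refine not_congr (exists_congr fun S => and_congr_right fun hS => ?_)
    rw [Function.update_self]
    refine and_congr_right fun _ => ?_
    constructor
    · intro h v hv hd
      refine h ⟨v, hS.1 hv, by simpa using hv, ?_⟩
      rw [ih hp' _ _ _ _ (by simpa using hS.1 hv), env_upd_false]
      simpa using hd
    · rintro h ⟨v, hvT, hv, hs⟩
      rw [ih hp' _ _ _ _ (by simpa using hvT), env_upd_false] at hs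
      rw [Function.update_self] at hv hs
      exact h v hv hs
  · intro Z O X θ hθ ih hp σ x V1 V2 hx
    have hp' := AllPos.nu_body hp
    rw [nu_iff K hθ hp' (env_sub K σ V2)]
    simp only [tr, Sat]
    refine exists_congr fun S => and_congr_right fun hS => ?_
    rw [Function.update_self]
    refine and_congr_right fun _ => ?_
    constructor
    · intro h v hv
      by_contra hd
      refine h ⟨v, hS.1 hv, by simpa using hv, ?_⟩
      rw [ih hp' _ _ _ _ (by simpa using hS.1 hv), env_upd_true K _ _ _ hS.1]
      simpa using hd
    · rintro h ⟨v, hvT, hv, hs⟩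
      rw [ih hp' _ _ _ _ (by simpa using hvT), env_upd_true K _ _ _ hS.1] at hs
      rw [Function.update_self] at hv hs
      exact hs (h hv)
  · intro Z O φ _ ih hp
    exact ih hp.1

/-! ### Free variables of the translation -/

theorem fo_child {AP : Type} (x y : ℕ) : (fChild x y : MSOL AP).freeFO ⊆ {x, y} := by
  intro z
  simp only [fChild, MSOL.freeFO, Set.mem_union, Set.mem_diff, Set.mem_insert_iff,
    Set.mem_singleton_iff]
  tauto

theorem so_child {AP : Type} (x y : ℕ) : (fChild x y : MSOL AP).freeSO = ∅ := by
  simp [fChild, MSOL.freeSO]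

theorem fo_diff {AP : Type} (x y j : ℕ) :
    (fDiff x y j : MSOL AP).freeFO ⊆ {z | z = y ∨ (x ≤ z ∧ z ≤ x + j)} := by
  induction j with
  | zero =>
    intro z
    simp only [fDiff, MSOL.freeFO, Set.mem_insert_iff, Set.mem_singleton_iff, Set.mem_setOf_eq]
    omega
  | succ j ih =>
    intro z hz
    simp only [fDiff, MSOL.freeFO, Set.mem_union, Set.mem_insert_iff, Set.mem_singleton_iff] at hz
    rcases hz with hz | hz
    · have := ih hz
      simp only [Set.mem_setOf_eq] at this ⊢
      omega
    · simp only [Set.mem_setOf_eq]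
      omega

theorem so_diff {AP : Type} (x y j : ℕ) : (fDiff x y j : MSOL AP).freeSO = ∅ := by
  induction j with
  | zero => simp [fDiff, MSOL.freeSO]
  | succ j ih => simp [fDiff, MSOL.freeSO, ih]

theorem fo_dia {AP : Type} (x : ℕ) (ψ : ℕ → MSOL AP) (hψ : ∀ y, (ψ y).freeFO ⊆ {y}) (k : ℕ) :
    ∀ j, (fDia x ψ j k).freeFO ⊆ {z | x ≤ z ∧ z ≤ x + j} := by
  induction k with
  | zero =>
    intro j z
    simp only [fDia, MSOL.freeFO, Set.mem_insert_iff, Set.mem_singleton_iff, Set.mem_setOf_eq]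
    omega
  | succ k ih =>
    rintro j z ⟨hz, hne⟩
    have hne : z ≠ x + j + 1 := hne
    rcases hz with (hz | hz) | (hz | hz)
    · have := fo_child _ _ hz
      simp only [Set.mem_insert_iff, Set.mem_singleton_iff, Set.mem_setOf_eq] at this ⊢
      omega
    · exact absurd (hψ _ hz) hne
    · have := fo_diff _ _ _ hz
      simp only [Set.mem_setOf_eq] at this ⊢
      omega
    · have := ih _ hz
      simp only [Set.mem_setOf_eq] at this ⊢
      omega

theorem so_dia {AP : Type} (x : ℕ) (ψ : ℕ → MSOL AP) (Q : Set ℕ) (hψ : ∀ y, (ψ y).freeSO ⊆ Q)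
    (k : ℕ) : ∀ j, (fDia x ψ j k).freeSO ⊆ Q := by
  induction k with
  | zero => intro j; exact Set.empty_subset _
  | succ k ih =>
    intro j
    simp only [fDia, MSOL.freeSO, so_child, so_diff, Set.empty_union]
    exact Set.union_subset (hψ _) (ih _)

theorem fo_tr {AP : Type} (φ : GMC AP) : ∀ σ x, (tr φ σ x).freeFO ⊆ {x} := by
  induction φ with
  | ff => intro σ x; simp [tr, MSOL.freeFO]
  | tt => intro σ x; simp [tr, MSOL.freeFO]
  | atom a => intro σ x; simp [tr, MSOL.freeFO]
  | not φ ih => intro σ x; exact ih σ x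
  | and φ ψ ih1 ih2 => intro σ x; exact Set.union_subset (ih1 σ x) (ih2 σ x)
  | or φ ψ ih1 ih2 => intro σ x; exact Set.union_subset (ih1 σ x) (ih2 σ x)
  | var X => intro σ x; by_cases h : σ X = true <;> simp [tr, h, MSOL.freeFO]
  | dia k φ ih =>
    intro σ x z hz
    have := fo_dia x (fun y => tr φ σ y) (fun y => ih σ y) k 0 hz
    simp only [Set.mem_setOf_eq, Set.mem_singleton_iff] at this ⊢
    omega
  | box k φ ih =>
    intro σ x z hz
    have := fo_dia x (fun y => .not (tr φ σ y)) (fun y => ih σ y) k 0 hz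
    simp only [Set.mem_setOf_eq, Set.mem_singleton_iff] at this ⊢
    omega
  | mu X φ ih =>
    intro σ x
    refine Set.union_subset subset_rfl ?_
    rintro z ⟨hz | hz, hne⟩
    · exact hz
    · exact ih _ _ hz
  | nu X φ ih =>
    intro σ x
    refine Set.union_subset subset_rfl ?_
    rintro z ⟨hz | hz, hne⟩
    · exact hz
    · exact ih _ _ hz

theorem so_tr {AP : Type} (φ : GMC AP) : ∀ σ x, (tr φ σ x).freeSO ⊆ φ.free := by
  induction φ with
  | ff => intro σ x; simp [tr, MSOL.freeSO]
  | tt => intro σ x; simp [tr, MSOL.freeSO]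
  | atom a => intro σ x; simp [tr, MSOL.freeSO]
  | not φ ih => intro σ x; exact ih σ x
  | and φ ψ ih1 ih2 => intro σ x; exact Set.union_subset_union (ih1 σ x) (ih2 σ x)
  | or φ ψ ih1 ih2 => intro σ x; exact Set.union_subset_union (ih1 σ x) (ih2 σ x)
  | var X => intro σ x; by_cases h : σ X = true <;> simp [tr, h, MSOL.freeSO, GMC.free]
  | dia k φ ih => intro σ x; exact so_dia x (fun y => tr φ σ y) _ (fun y => ih σ y) k 0
  | box k φ ih => intro σ x; exact so_dia x (fun y => .not (tr φ σ y)) _ (fun y => ih σ y) k 0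
  | mu X φ ih =>
    rintro σ x z ⟨hz | hz | hz, hne⟩
    · exact absurd hz hne
    · exact absurd hz hne
    · exact ⟨ih _ _ hz, hne⟩
  | nu X φ ih =>
    rintro σ x z ⟨hz | hz | hz, hne⟩
    · exact absurd hz hne
    · exact absurd hz hne
    · exact ⟨ih _ _ hz, hne⟩

/-- The sentence: the translation holds at the root. -/
def sent {AP : Type} (θ : GMC AP) : MSOL AP :=
  .exFO 0 (.and (.not (.exFO 1 (.not (.le 0 1)))) (tr θ (fun _ => true) 0))

end OSG

/-- OSGμC ≤ MTL. Every OSGμC sentence has an MTL sentence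
satisfied by exactly the same Kripke trees; more precisely, there is a
translation `t x θ` from OSGμC fixpoint formulas to MTL formulas such that a
node `w` belongs to the denotation of `θ` under an assignment `V` iff the
Kripke tree satisfies `t x θ` under the first-order valuation mapping `x` to
`w` and the second-order valuation `V`. -/
theorem stmt17 (AP : Type) [Fintype AP] :
    (∀ θ : GMC AP, IsFix ∅ ∅ θ → θ.AllPos →
      ∃ φ : MSOL AP, φ.IsSentence ∧
        ∀ K : KripkeTree AP, (GKSat K θ ↔ (MTL AP).KSat K φ)) ∧
    (∃ t : ℕ → GMC AP → MSOL AP,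
      ∀ (Z O : Set ℕ) (θ : GMC AP), IsFix Z O θ → θ.AllPos →
        ∀ (K : KripkeTree AP) (V : ℕ → Set Node), (∀ X : ℕ, V X ⊆ K.T) →
          ∀ w ∈ K.T, ∀ (x : ℕ) (V1 : ℕ → Node),
            (w ∈ GMC.denot K θ V ↔
              Sat MTLdom K (Function.update V1 x w) V (t x θ))) := by
  refine ⟨fun θ hθ hp => ⟨OSG.sent θ, ⟨?_, ?_⟩, fun K => ?_⟩,
    fun x θ => OSG.tr θ (fun _ => true) x, ?_⟩
  · ext z
    simp only [Set.mem_empty_iff_false, iff_false]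
    rintro ⟨⟨hz, hne⟩ | hz, hne0⟩
    · rcases hz with h | h
      · exact hne0 h
      · exact hne h
    · exact hne0 (OSG.fo_tr θ _ _ hz)
  · ext z
    simp only [Set.mem_empty_iff_false, iff_false]
    rintro (hz | hz)
    · exact hz
    · exact OSG.closed_free hθ z (OSG.so_tr θ _ _ hz)
  · have key : ∀ (V1 : ℕ → Node) (V2 : ℕ → Set Node),
        Sat MTLdom K V1 V2 (OSG.sent θ) ↔ GKSat K θ := by
      intro V1 V2
      have hg : ∀ τ ∈ K.T, (Sat MTLdom K (Function.update V1 0 τ) V2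
          (OSG.tr θ (fun _ => true) 0) ↔ τ ∈ GMC.denot K θ (fun _ => ∅)) := by
        intro τ hτ
        rw [OSG.good K hθ hp _ _ _ _ (by simpa using hτ), Function.update_self,
          OSG.denot_congr K θ _ (fun _ => ∅) (fun X hX => absurd hX (OSG.closed_free hθ X))]
      have hr : ∀ τ ∈ K.T, (Sat MTLdom K (Function.update V1 0 τ) V2
          (.not (.exFO 1 (.not (.le 0 1)))) ↔ τ = K.root) := by
        intro τ hτ
        simp only [Sat]
        constructor
        · intro h
          by_contra hne
          refine h ⟨K.root, K.rooted.1, fun hh => hne ?_⟩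
          have h3 := hh.2.2
          simp at h3
          exact OSG.pre_antisymm h3 (K.rooted.2.1 τ hτ)
        · rintro rfl ⟨v, hv, hn⟩
          apply hn
          simp [hv, hτ, K.rooted.2.1 v hv]
      constructor
      · rintro ⟨τ, hτ, h1, h2⟩
        have e := (hr τ hτ).1 h1
        have := (hg τ hτ).1 h2
        rw [e] at this
        exact this
      · intro h
        exact ⟨K.root, K.rooted.1, (hr _ K.rooted.1).2 rfl, (hg _ K.rooted.1).2 h⟩
    constructor
    · intro h
      exact ⟨fun _ => [], fun _ => ∅, (key _ _).2 h⟩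
    · rintro ⟨V1, V2, h⟩
      exact (key V1 V2).1 h
  · intro Z O θ hθ hp K V hV w hw x V1
    rw [OSG.good K hθ hp _ _ _ _ (by simpa using hw), Function.update_self]
    have : OSG.env K (fun _ => true) V = V := by
      funext X
      simpa [OSG.env] using hV X
    rw [this]
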